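/- arXiv:2101.08696 — 2 statements merged into one kernel-verified Lean document; each statement's English description precedes it below -/
import Mathlib

section
/- Let K ≥ 1 be an integer, σ_N² > 0, and D > σ_N²/K. For any r₁, …, r_K ≥ 0 satisfying Σ_{k=1}^K (1 − exp(−2·r_k)) = σ_N²/D, one has Σ_{k=1}^K r_k ≥ −(K/2)·ln(1 − σ_N²/(K·D)). Moreover, equality is attained by the symmetric choice r_k = −(1/2)·ln(1 − σ_N²/(K·D)) for all k, which is nonnegative and satisfies the constraint. -/
/-- Quantization-rate optimization underlying Corollary 1: minimum of `∑ r_k`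
subject to `∑ (1 - e^{-2 r_k}) = σ_N²/D` is `-(K/2) ln(1 - σ_N²/(KD))`,
attained at the symmetric choice. -/
theorem stmt_7 (K : ℕ) (hK : 1 ≤ K) (σN2 D : ℝ) (hσ : 0 < σN2) (hD : σN2 / K < D) :
    (∀ r : Fin K → ℝ, (∀ k, 0 ≤ r k) →
        (∑ k, (1 - Real.exp (-2 * r k))) = σN2 / D →
        ∑ k, r k ≥ -((K : ℝ) / 2) * Real.log (1 - σN2 / (K * D))) ∧
      (0 ≤ -(1 / 2 : ℝ) * Real.log (1 - σN2 / (K * D)) ∧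
        (∑ _k : Fin K, (1 - Real.exp (-2 * (-(1 / 2 : ℝ) * Real.log (1 - σN2 / (K * D))))))
          = σN2 / D ∧
        (∑ _k : Fin K, -(1 / 2 : ℝ) * Real.log (1 - σN2 / (K * D)))
          = -((K : ℝ) / 2) * Real.log (1 - σN2 / (K * D))) := by
  have hK0 : (0 : ℝ) < K := by exact_mod_cast hK
  have hD0 : 0 < D := lt_trans (div_pos hσ hK0) hD
  have hlt : σN2 / (K * D) < 1 := by
    rw [div_lt_one (by positivity)]
    rw [div_lt_iff₀ hK0] at hD
    linarith
  have hpos : 0 < σN2 / (K * D) := by positivity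
  have hKs : (K : ℝ) * (σN2 / (K * D)) = σN2 / D := by field_simp
  generalize σN2 / (K * D) = s at *
  have ha : 0 < 1 - s := by linarith
  have hexp : Real.exp (Real.log (1 - s)) = 1 - s := Real.exp_log ha
  have hL : Real.log (1 - s) ≤ 0 := Real.log_nonpos ha.le (by linarith)
  generalize Real.log (1 - s) = L at *
  refine ⟨fun r _ hsum => ?_, by linarith, ?_, ?_⟩
  · have h1 : ∀ k, (1 - s) * (1 - L - 2 * r k) ≤ Real.exp (-2 * r k) := by
      intro k
      have h2 := Real.add_one_le_exp (-2 * r k - L)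
      have h3 : Real.exp (-2 * r k) = (1 - s) * Real.exp (-2 * r k - L) := by
        rw [← hexp, ← Real.exp_add]
        congr 1
        ring
      rw [h3]
      exact mul_le_mul_of_nonneg_left (by linarith) ha.le
    have h4 := Finset.sum_le_sum (fun k (_ : k ∈ Finset.univ) => h1 k)
    rw [← Finset.mul_sum, Finset.sum_sub_distrib, ← Finset.mul_sum] at h4
    rw [Finset.sum_sub_distrib] at hsum
    simp only [Finset.sum_const, Finset.card_univ, Fintype.card_fin, nsmul_eq_mul] at h4 hsum
    have h5 : (1 - s) * (K * (1 - L) - 2 * ∑ k, r k) ≤ (1 - s) * K := by linarith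
    have h6 := le_of_mul_le_mul_left h5 ha
    linarith
  · have h7 : -2 * (-(1 / 2 : ℝ) * L) = L := by ring
    rw [h7, hexp]
    simp [hKs]
  · simp
    ring
end

section
/- Let K ≥ 1 be an integer, σ_N² > 0, σ_X² > 0, and define f(D) = −(K/2)·ln(1 − σ_N²/(K·D)) + (1/2)·ln(1 + σ_X²/D) for D > σ_N²/K. Let P ≥ 1 be an integer, let D̄ > σ_N²/K, and let D₁, …, D_P be reals with D_p > σ_N²/K for all p and Σ_{p=1}^P D_p ≤ P·D̄. Then Σ_{p=1}^P f(D_p) ≥ P·f(D̄). -/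
lemma aux_tangent (c x y : ℝ) (hc : 0 < c) (hx : 0 < x) (hy : 0 < y) :
    Real.log (1 + c / y) + c / (y * (y + c)) * (y - x) ≤ Real.log (1 + c / x) := by
  have hu : 0 < (1 + c / x) / (1 + c / y) := by positivity
  have h1 := Real.one_sub_inv_le_log_of_pos hu
  rw [Real.log_div (by positivity) (by positivity)] at h1
  have h2 : 1 - ((1 + c / x) / (1 + c / y))⁻¹ - c / (y * (y + c)) * (y - x)
      = c * (y - x) ^ 2 / (y * (x + c) * (y + c)) := by
    have e1 : 1 + c / x = (x + c) / x := by field_simp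
    have e2 : 1 + c / y = (y + c) / y := by field_simp
    rw [e1, e2]
    have : x + c ≠ 0 := by positivity
    have : y + c ≠ 0 := by positivity
    field_simp
    ring
  have h3 : 0 ≤ c * (y - x) ^ 2 / (y * (x + c) * (y + c)) := by positivity
  linarith

lemma aux_log (K s x : ℝ) (hK : 0 < K) (hs : 0 < s) (hx : s / K < x) :
    Real.log (1 - s / (K * x)) = - Real.log (1 + (s / K) / (x - s / K)) := by
  have ha : 0 < s / K := by positivity
  have hx0 : 0 < x := ha.trans hx
  have hd : x - s / K ≠ 0 := (sub_pos.2 hx).ne'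
  rw [← Real.log_inv, ← div_div]
  congr 1
  generalize s / K = a at *
  have e : 1 + a / (x - a) = x / (x - a) := by field_simp; ring
  rw [e, inv_div]
  field_simp

/-- Jensen-type equal-allocation bound: for the convex decreasing sum-rate-distortion
function `f`, any distortion allocation with average at most `D̄` has total rate at
least `P·f(D̄)`. -/
theorem stmt_11 (K : ℕ) (hK : 1 ≤ K) (σN2 σX2 : ℝ) (hN : 0 < σN2) (hX : 0 < σX2)
    (P : ℕ) (hP : 1 ≤ P) (Dbar : ℝ) (hDbar : σN2 / K < Dbar)
    (Dp : Fin P → ℝ) (hDp : ∀ p, σN2 / K < Dp p) (hsum : ∑ p, Dp p ≤ (P : ℝ) * Dbar) :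
    ∑ p, (-((K : ℝ) / 2) * Real.log (1 - σN2 / (K * Dp p))
        + (1 / 2) * Real.log (1 + σX2 / Dp p)) ≥
      (P : ℝ) * (-((K : ℝ) / 2) * Real.log (1 - σN2 / (K * Dbar))
        + (1 / 2) * Real.log (1 + σX2 / Dbar)) := by
  have hK' : (0:ℝ) < K := by exact_mod_cast hK
  have ha : 0 < σN2 / K := by positivity
  have hD0 : 0 < Dbar := ha.trans hDbar
  have hE0 : 0 < Dbar - σN2 / K := sub_pos.2 hDbar
  obtain ⟨m, hm, hm0⟩ : ∃ m : ℝ, (∀ p, (-((K : ℝ) / 2) * Real.log (1 - σN2 / (K * Dbar))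
        + (1 / 2) * Real.log (1 + σX2 / Dbar)) + m * (Dbar - Dp p) ≤
        (-((K : ℝ) / 2) * Real.log (1 - σN2 / (K * Dp p))
        + (1 / 2) * Real.log (1 + σX2 / Dp p))) ∧ 0 ≤ m := by
    refine ⟨(K : ℝ) / 2 * ((σN2 / K) / ((Dbar - σN2 / K) * ((Dbar - σN2 / K) + σN2 / K)))
      + 1 / 2 * (σX2 / (Dbar * (Dbar + σX2))), fun p => ?_, by positivity⟩
    have h1 := aux_tangent σX2 (Dp p) Dbar hX (ha.trans (hDp p)) hD0
    have h2 := aux_tangent (σN2 / K) (Dp p - σN2 / K) (Dbar - σN2 / K) ha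
      (sub_pos.2 (hDp p)) hE0
    rw [aux_log K σN2 _ hK' hN hDbar, aux_log K σN2 _ hK' hN (hDp p)]
    rw [sub_sub_sub_cancel_right] at h2
    have h3 := mul_le_mul_of_nonneg_left h2 (by positivity : (0:ℝ) ≤ (K : ℝ) / 2)
    linarith
  have h := Finset.sum_le_sum (fun p (_ : p ∈ Finset.univ) => hm p)
  rw [Finset.sum_add_distrib, ← Finset.mul_sum, Finset.sum_sub_distrib] at h
  simp only [Finset.sum_const, Finset.card_univ, Fintype.card_fin, nsmul_eq_mul] at h
  have h4 := mul_nonneg hm0 (sub_nonneg.2 hsum)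
  exact le_trans (le_add_of_nonneg_right h4) h
end
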